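/- arXiv:2411.02266 — 2 statements merged into one kernel-verified Lean document; each statement's English description precedes it below -/
import Mathlib

section
/- Let k be a field, R = k⟦t₁,…,t_n⟧ with fraction field K, and H̃ a finite free R-module with a direct sum decomposition H̃ = ⊕_{i∈I} H̃_i into finite free R-submodules (I finite). Let U ∈ End_R(H̃) with U(H̃_i) ⊆ H̃_i for all i, and assume that for all i ≠ j the characteristic polynomials of U|_{H̃_i} and U|_{H̃_j} (monic polynomials in R[X]) are coprime when viewed in K[X]. Then every X ∈ End_R(H̃) such that the commutator XU − UX lies in ⊕_{i∈I} End_R(H̃_i) satisfies X ∈ ⊕_{i∈I} End_R(H̃_i). -/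
/-!
STATEMENT 8: If the commutator `[X,U]` is block diagonal for a block-diagonal `U`
with restrictions of pairwise coprime characteristic polynomials over the
fraction field of `k⟦t₁,…,t_n⟧`, then `X` is block diagonal
(Lemma `lemma:commutator-splits-implies-splits`).
-/

open Polynomial in
/-- Coprimality over the fraction field yields a Bézout identity over the domain itself, up to a
nonzero constant. -/
theorem exists_mul_add_mul_eq_C_of_isCoprime_map {R : Type*} [CommRing R] [IsDomain R] {p q : R[X]}
    (h : IsCoprime (p.map (algebraMap R (FractionRing R)))
      (q.map (algebraMap R (FractionRing R)))) :
    ∃ (a b : R[X]) (r : R), r ≠ 0 ∧ a * p + b * q = C r := by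
  obtain ⟨a, b, hab⟩ := h
  obtain ⟨c, hc, ha⟩ := IsLocalization.integerNormalization_spec (nonZeroDivisors R) a
  obtain ⟨d, hd, hb⟩ := IsLocalization.integerNormalization_spec (nonZeroDivisors R) b
  refine ⟨C d * IsLocalization.integerNormalization (nonZeroDivisors R) a,
    C c * IsLocalization.integerNormalization (nonZeroDivisors R) b, c * d,
    mul_ne_zero (nonZeroDivisors.ne_zero hc) (nonZeroDivisors.ne_zero hd), ?_⟩
  apply map_injective _ (IsFractionRing.injective R (FractionRing R))
  rw [Algebra.smul_def] at ha hb
  simp only [Polynomial.map_add, Polynomial.map_mul, ha, hb, map_C, Polynomial.algebraMap_apply,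
    map_mul]
  linear_combination C (algebraMap R (FractionRing R) c) * C (algebraMap R (FractionRing R) d) * hab

open Polynomial in
/-- A linear map intertwining two endomorphisms intertwines every polynomial in them. -/
theorem LinearMap.comp_aeval_of_comp_eq {R M N : Type*} [CommRing R]
    [AddCommGroup M] [Module R M] [AddCommGroup N] [Module R N]
    {f : Module.End R M} {g : Module.End R N} {Y : M →ₗ[R] N} (hY : Y ∘ₗ f = g ∘ₗ Y) (p : R[X]) :
    Y ∘ₗ aeval f p = aeval g p ∘ₗ Y := by
  have hY' (x : M) : Y (f x) = g (Y x) := LinearMap.congr_fun hY x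
  induction p using Polynomial.induction_on with
  | C a => ext x; simp
  | add p q hp hq => simp [LinearMap.comp_add, LinearMap.add_comp, hp, hq]
  | monomial n a h =>
    ext x
    have h' := LinearMap.congr_fun h (f x)
    simp only [map_mul, map_pow, aeval_X, aeval_C, LinearMap.comp_apply, pow_succ,
      Module.End.mul_apply] at h' ⊢
    rw [h', hY']

open Polynomial in
/-- A linear map into a torsion-free module intertwining two endomorphisms annihilated by
polynomials that are coprime over the fraction field vanishes. -/
theorem LinearMap.eq_zero_of_comp_eq_of_isCoprime_map {R M N : Type*} [CommRing R] [IsDomain R]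
    [AddCommGroup M] [Module R M] [AddCommGroup N] [Module R N] [Module.IsTorsionFree R N]
    {f : Module.End R M} {g : Module.End R N} {Y : M →ₗ[R] N} (hY : Y ∘ₗ f = g ∘ₗ Y)
    {p q : R[X]} (hp : aeval f p = 0) (hq : aeval g q = 0)
    (h : IsCoprime (p.map (algebraMap R (FractionRing R)))
      (q.map (algebraMap R (FractionRing R)))) : Y = 0 := by
  obtain ⟨a, b, r, hr, hab⟩ := exists_mul_add_mul_eq_C_of_isCoprime_map h
  have hpY : aeval g p ∘ₗ Y = 0 := by rw [← comp_aeval_of_comp_eq hY, hp, LinearMap.comp_zero]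
  ext x
  have hx := LinearMap.congr_fun (congrArg (aeval g) hab) (Y x)
  have hpx : aeval g p (Y x) = 0 := LinearMap.congr_fun hpY x
  simp only [map_add, map_mul, hq, mul_zero, add_zero, Module.End.mul_apply, hpx, map_zero,
    aeval_C, Module.algebraMap_end_apply] at hx
  exact (smul_eq_zero.mp hx.symm).resolve_left hr

/-- An endomorphism preserving every summand commutes with taking components. -/
theorem DirectSum.decompose_apply_of_mapsTo {R H I : Type*} [CommRing R]
    [AddCommGroup H] [Module R H] [DecidableEq I] (A : I → Submodule R H)
    [DirectSum.Decomposition A] {U : Module.End R H} (hU : ∀ i, ∀ x ∈ A i, U x ∈ A i)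
    (x : H) (j : I) :
    (DirectSum.decompose A (U x) j : H) = U (DirectSum.decompose A x j) := by
  induction x using DirectSum.Decomposition.inductionOn A with
  | zero => simp
  | @homogeneous i m =>
    by_cases hij : i = j
    · subst hij
      rw [DirectSum.decompose_of_mem_same A (hU i _ m.2), DirectSum.decompose_of_mem_same A m.2]
    · rw [DirectSum.decompose_of_mem_ne A (hU i _ m.2) hij,
        DirectSum.decompose_of_mem_ne A m.2 hij, map_zero]
  | add a b ha hb => simp [DirectSum.decompose_add, ha, hb]

theorem stmt8 {k : Type*} [Field k] {n : ℕ}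
    {H : Type*} [AddCommGroup H] [Module (MvPowerSeries (Fin n) k) H]
    [Module.Free (MvPowerSeries (Fin n) k) H] [Module.Finite (MvPowerSeries (Fin n) k) H]
    {I : Type*} [Fintype I] [DecidableEq I]
    (Hsub : I → Submodule (MvPowerSeries (Fin n) k) H)
    [∀ i, Module.Free (MvPowerSeries (Fin n) k) (Hsub i)]
    [∀ i, Module.Finite (MvPowerSeries (Fin n) k) (Hsub i)]
    (hint : DirectSum.IsInternal Hsub)
    (U : Module.End (MvPowerSeries (Fin n) k) H)
    (hU : ∀ i : I, ∀ x ∈ Hsub i, U x ∈ Hsub i)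
    -- the characteristic polynomials of the restrictions are pairwise coprime in `K[X]`
    (hcop : ∀ i j : I, i ≠ j →
      IsCoprime
        ((LinearMap.charpoly (U.restrict (hU i))).map
          (algebraMap (MvPowerSeries (Fin n) k) (FractionRing (MvPowerSeries (Fin n) k))))
        ((LinearMap.charpoly (U.restrict (hU j))).map
          (algebraMap (MvPowerSeries (Fin n) k) (FractionRing (MvPowerSeries (Fin n) k)))))
    (X : Module.End (MvPowerSeries (Fin n) k) H)
    -- the commutator `X∘U − U∘X` is block diagonal
    (hX : ∀ i : I, ∀ x ∈ Hsub i, (X * U - U * X) x ∈ Hsub i) :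
    -- then `X` is block diagonal
    ∀ i : I, ∀ x ∈ Hsub i, X x ∈ Hsub i := by
  classical
  let := hint.chooseDecomposition
  have : IsDomain (MvPowerSeries (Fin n) k) := NoZeroDivisors.to_isDomain _
  intro i x hx
  have key (j : I) (hij : i ≠ j) : (DirectSum.decompose Hsub (X x) j : H) = 0 := by
    let Y : Hsub i →ₗ[MvPowerSeries (Fin n) k] Hsub j :=
      DirectSum.component _ I (fun i => Hsub i) j ∘ₗ
        (DirectSum.decomposeLinearEquiv Hsub).toLinearMap ∘ₗ X ∘ₗ (Hsub i).subtype
    have hYU : Y ∘ₗ U.restrict (hU i) = U.restrict (hU j) ∘ₗ Y := by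
      ext y
      change (DirectSum.decompose Hsub (X (U y)) j : H) = U (DirectSum.decompose Hsub (X y) j)
      have h := DirectSum.decompose_of_mem_ne Hsub (hX i y y.2) hij
      rw [LinearMap.sub_apply, DirectSum.decompose_sub] at h
      rw [← DirectSum.decompose_apply_of_mapsTo Hsub hU, ← sub_eq_zero]
      exact h
    have hY : Y = 0 := LinearMap.eq_zero_of_comp_eq_of_isCoprime_map hYU
      (LinearMap.aeval_self_charpoly _) (LinearMap.aeval_self_charpoly _) (hcop i j hij)
    exact congrArg Subtype.val (LinearMap.congr_fun hY ⟨x, hx⟩)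
  rw [← DirectSum.sum_support_decompose Hsub (X x)]
  refine Submodule.sum_mem _ fun j _ => ?_
  by_cases hij : i = j
  · subst hij
    exact SetLike.coe_mem _
  · rw [key j hij]
    exact Submodule.zero_mem _
end

section
/- Let f : X → B be a continuous closed map of topological spaces with X Hausdorff, let b ∈ B, let I be a finite set, and let (X_{b,i})_{i∈I} be pairwise disjoint compact subsets of X whose union is the fiber f^{-1}({b}). Then there exist an open neighborhood U of b in B and pairwise disjoint open subsets (W_i)_{i∈I} of X such that f^{-1}(U) = ⋃_{i∈I} W_i and W_i ∩ f^{-1}({b}) = X_{b,i} for every i. -/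
/-!
STATEMENT 11: Separating the pieces of a fiber of a closed map into disjoint
open sets (Lemma `lemma:topological-connected-components`).
-/

/-- Finitely many pairwise disjoint compact sets in a Hausdorff space have pairwise disjoint open
neighborhoods. -/
theorem exists_pairwise_disjoint_open_of_isCompact {X I : Type*} [TopologicalSpace X] [T2Space X]
    [Finite I] {K : I → Set X} (hK : ∀ i, IsCompact (K i))
    (hdisj : Pairwise fun i j => Disjoint (K i) (K j)) :
    ∃ V : I → Set X, (∀ i, IsOpen (V i)) ∧ (∀ i, K i ⊆ V i) ∧
      Pairwise fun i j => Disjoint (V i) (V j) := by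
  have hnhds : Pairwise fun i j => Disjoint (nhdsSet (K i)) (nhdsSet (K j)) := fun i j hij =>
    separatedNhds_iff_disjoint.1
      (SeparatedNhds.of_isCompact_isCompact (hK i) (hK j) (hdisj hij))
  obtain ⟨V, hV, hVd⟩ :=
    hnhds.exists_mem_filter_basis_of_disjoint fun i => hasBasis_nhdsSet (K i)
  exact ⟨V, fun i => (hV i).1, fun i => (hV i).2, hVd⟩

theorem stmt11 {X B : Type*} [TopologicalSpace X] [TopologicalSpace B] [T2Space X]
    (f : X → B) (hcont : Continuous f) (hclosed : IsClosedMap f) (b : B)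
    {I : Type*} [Finite I] (Xb : I → Set X)
    (hcomp : ∀ i, IsCompact (Xb i))
    (hdisj : ∀ i j : I, i ≠ j → Disjoint (Xb i) (Xb j))
    (hcover : ⋃ i, Xb i = f ⁻¹' {b}) :
    ∃ U : Set B, IsOpen U ∧ b ∈ U ∧
      ∃ W : I → Set X,
        (∀ i, IsOpen (W i)) ∧
        (∀ i j : I, i ≠ j → Disjoint (W i) (W j)) ∧
        f ⁻¹' U = ⋃ i, W i ∧
        ∀ i, W i ∩ f ⁻¹' {b} = Xb i := by
  obtain ⟨V, hVo, hKV, hVd⟩ :=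
    exists_pairwise_disjoint_open_of_isCompact hcomp fun i j hij => hdisj i j hij
  have hsub : ∀ i, Xb i ⊆ f ⁻¹' {b} := fun i => hcover ▸ Set.subset_iUnion Xb i
  have hU : IsOpen (Set.kernImage f (⋃ i, V i)) :=
    isClosedMap_iff_kernImage.1 hclosed (isOpen_iUnion hVo)
  have hbU : b ∈ Set.kernImage f (⋃ i, V i) := fun x hx =>
    Set.iUnion_mono hKV (hcover ▸ hx : x ∈ ⋃ i, Xb i)
  refine ⟨_, hU, hbU, fun i => V i ∩ f ⁻¹' Set.kernImage f (⋃ i, V i),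
    fun i => (hVo i).inter (hU.preimage hcont),
    fun i j hij => (hVd hij).mono Set.inter_subset_left Set.inter_subset_left, ?_, fun i => ?_⟩
  · rw [← Set.iUnion_inter]
    exact (Set.inter_eq_right.2 (Set.preimage_kernImage.l_u_le _)).symm
  · refine Set.Subset.antisymm ?_ fun x hx => ⟨⟨hKV i hx, ?_⟩, hsub i hx⟩
    · rintro x ⟨⟨hxV, -⟩, hxb⟩
      obtain ⟨j, hj⟩ := Set.mem_iUnion.1 (hcover ▸ hxb : x ∈ ⋃ i, Xb i)
      obtain rfl : i = j := by
        by_contra hij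
        exact Set.disjoint_left.1 (hVd hij) hxV (hKV j hj)
      exact hj
    · have hfx : f x = b := hsub i hx
      rwa [Set.mem_preimage, hfx]
end
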